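/- arXiv:1804.09026 — 2 statements merged into one kernel-verified Lean document; each statement's English description precedes it below -/
import Mathlib

section
/- Let A be a unital C*-algebra and let a ∈ A be selfadjoint. Let g : ℝ → ℝ be the function g(x) = x/√(1+x²). Then g(a), defined via the continuous functional calculus, is equal to the Bochner integral (2/π)·∫₁^∞ (s/√(s²−1)) · a·(a² + s²·1)⁻¹ ds, where for each s ≥ 1 the element a² + s²·1 is invertible in A. -/
open MeasureTheory

lemma aux_deriv (x s : ℝ) (hs : 1 < s) :
    HasDerivAt (fun s : ℝ => Real.arctan (Real.sqrt (s ^ 2 - 1) / Real.sqrt (1 + x ^ 2)) /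
      Real.sqrt (1 + x ^ 2)) (s / Real.sqrt (s ^ 2 - 1) * (x ^ 2 + s ^ 2)⁻¹) s := by
  have h1 : 0 < s ^ 2 - 1 := by nlinarith
  have hc : 0 < 1 + x ^ 2 := by positivity
  have h2 : HasDerivAt (fun s : ℝ => s ^ 2 - 1) (2 * s) s := by
    simpa using (hasDerivAt_pow 2 s).sub_const 1
  have h3 := (((h2.sqrt h1.ne').div_const (Real.sqrt (1 + x ^ 2))).arctan).div_const
    (Real.sqrt (1 + x ^ 2))
  refine h3.congr_deriv (Eq.symm ?_)
  have hq := Real.sqrt_pos.2 h1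
  have hd := Real.sqrt_pos.2 hc
  have e1 := Real.sq_sqrt h1.le
  have e2 := Real.sq_sqrt hc.le
  rw [div_pow, e1, e2]
  have : 1 + (s ^ 2 - 1) / (1 + x ^ 2) = (x ^ 2 + s ^ 2) / (1 + x ^ 2) := by
    field_simp; ring
  rw [this]
  have h4 : 0 < x ^ 2 + s ^ 2 := by positivity
  field_simp
  rw [e2]

lemma aux_cont (x : ℝ) : Continuous
    (fun s : ℝ => Real.arctan (Real.sqrt (s ^ 2 - 1) / Real.sqrt (1 + x ^ 2)) /
      Real.sqrt (1 + x ^ 2)) := by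
  fun_prop

lemma aux_tend (x : ℝ) : Filter.Tendsto
    (fun s : ℝ => Real.arctan (Real.sqrt (s ^ 2 - 1) / Real.sqrt (1 + x ^ 2)) /
      Real.sqrt (1 + x ^ 2)) Filter.atTop (nhds (Real.pi / 2 / Real.sqrt (1 + x ^ 2))) := by
  have hd : 0 < Real.sqrt (1 + x ^ 2) := Real.sqrt_pos.2 (by positivity)
  apply Filter.Tendsto.div_const
  refine (Real.tendsto_arctan_atTop.mono_right nhdsWithin_le_nhds).comp ?_
  apply Filter.Tendsto.atTop_div_const hd
  apply Real.tendsto_sqrt_atTop.comp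
  exact Filter.tendsto_atTop_add_const_right _ (-1) (Filter.tendsto_pow_atTop two_ne_zero)

lemma aux_nonneg (x s : ℝ) (hs : 1 < s) :
    0 ≤ s / Real.sqrt (s ^ 2 - 1) * (x ^ 2 + s ^ 2)⁻¹ := by positivity

lemma aux_int (x : ℝ) : IntegrableOn
    (fun s : ℝ => s / Real.sqrt (s ^ 2 - 1) * (x ^ 2 + s ^ 2)⁻¹) (Set.Ioi 1) :=
  integrableOn_Ioi_deriv_of_nonneg (aux_cont x).continuousWithinAt
    (fun s hs => aux_deriv x s hs) (fun s hs => aux_nonneg x s hs) (aux_tend x)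

lemma aux_integral (x : ℝ) : ∫ s in Set.Ioi (1 : ℝ),
    s / Real.sqrt (s ^ 2 - 1) * (x ^ 2 + s ^ 2)⁻¹ = Real.pi / 2 / Real.sqrt (1 + x ^ 2) := by
  rw [integral_Ioi_of_hasDerivAt_of_nonneg (aux_cont x).continuousWithinAt
    (fun s hs => aux_deriv x s hs) (fun s hs => aux_nonneg x s hs) (aux_tend x)]
  simp

lemma aux_cfc {A : Type*} [CStarAlgebra A] (a : A) (ha : IsSelfAdjoint a) (s : ℝ) :
    cfc (fun x : ℝ => x ^ 2 + s ^ 2) a = a ^ 2 + ((s : ℂ) ^ 2) • (1 : A) := by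
  rw [cfc_add_const (s ^ 2) (fun x : ℝ => x ^ 2) a, cfc_pow_id a 2]
  congr 1
  rw [Algebra.algebraMap_eq_smul_one, ← Complex.ofReal_pow, Complex.coe_smul]

/-- integral representation of `g(a)`, the main tool in Lemma 3.4.
Let `a` be a selfadjoint element of a unital C*-algebra `A` and let
`g(x) = x/√(1+x²)`.  Then for each `s ≥ 1` the element `a² + s²·1` is invertible,
and `g(a)` (via the continuous functional calculus) equals the Bochner integral
`(2/π)·∫₁^∞ (s/√(s²−1)) · a·(a² + s²·1)⁻¹ ds`. -/
theorem statement6 {A : Type*} [CStarAlgebra A]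
    (a : A) (ha : IsSelfAdjoint a) :
    (∀ s : ℝ, 1 ≤ s → IsUnit (a ^ 2 + ((s : ℂ) ^ 2) • (1 : A))) ∧
    cfc (fun x : ℝ => x / Real.sqrt (1 + x ^ 2)) a =
      (2 / Real.pi) • ∫ s in Set.Ioi (1 : ℝ),
        (s / Real.sqrt (s ^ 2 - 1)) •
          (a * Ring.inverse (a ^ 2 + ((s : ℂ) ^ 2) • (1 : A))) := by
  have hne : ∀ s : ℝ, 1 ≤ s → ∀ x : ℝ, x ^ 2 + s ^ 2 ≠ 0 := fun s hs x => by positivity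
  constructor
  · intro s hs
    rw [← aux_cfc a ha s]
    exact (isUnit_cfc_iff (fun x : ℝ => x ^ 2 + s ^ 2) a).2 fun x _ => hne s hs x
  have key : ∀ s ∈ Set.Ioi (1 : ℝ), (s / Real.sqrt (s ^ 2 - 1)) •
          (a * Ring.inverse (a ^ 2 + ((s : ℂ) ^ 2) • (1 : A))) =
      cfc (fun x : ℝ => s / Real.sqrt (s ^ 2 - 1) * (x * (x ^ 2 + s ^ 2)⁻¹)) a := by
    intro s hs
    have hs' : (1 : ℝ) ≤ s := le_of_lt hs
    have hc : ContinuousOn (fun x : ℝ => (x ^ 2 + s ^ 2)⁻¹) (spectrum ℝ a) :=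
      ContinuousOn.inv₀ (by fun_prop) fun x _ => hne s hs' x
    rw [cfc_const_mul _ (fun x : ℝ => x * (x ^ 2 + s ^ 2)⁻¹) a (continuousOn_id.mul hc),
      cfc_mul (fun x : ℝ => x) (fun x : ℝ => (x ^ 2 + s ^ 2)⁻¹) a continuousOn_id hc,
      cfc_inv (fun x : ℝ => x ^ 2 + s ^ 2) a (fun x _ => hne s hs' x), cfc_id' ℝ a,
      aux_cfc a ha s]
  rw [setIntegral_congr_fun measurableSet_Ioi key]
  obtain ⟨M, hM⟩ := (spectrum.isBounded a (𝕜 := ℝ)).exists_norm_le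
  rw [← cfc_setIntegral measurableSet_Ioi
    (fun s x : ℝ => s / Real.sqrt (s ^ 2 - 1) * (x * (x ^ 2 + s ^ 2)⁻¹))
    (fun s => M * (s / Real.sqrt (s ^ 2 - 1) * (0 ^ 2 + s ^ 2)⁻¹)) a ?_ ?_
    ((aux_int 0).const_mul M).2]
  · have hfun : (fun r : ℝ => ∫ s in Set.Ioi (1 : ℝ),
        s / Real.sqrt (s ^ 2 - 1) * (r * (r ^ 2 + s ^ 2)⁻¹)) =
        fun r : ℝ => Real.pi / 2 * (r / Real.sqrt (1 + r ^ 2)) := by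
      funext r
      simp_rw [mul_left_comm _ r]
      rw [integral_const_mul, aux_integral]
      ring
    have hc : ContinuousOn (fun x : ℝ => x / Real.sqrt (1 + x ^ 2)) (spectrum ℝ a) :=
      ContinuousOn.div (by fun_prop) (by fun_prop)
        fun x _ => (Real.sqrt_pos.2 (by positivity)).ne'
    rw [hfun, cfc_const_mul _ _ a hc, smul_smul]
    have : 2 / Real.pi * (Real.pi / 2) = 1 := by
      field_simp
    rw [this, one_smul]
  · have h1 : ∀ p ∈ Set.Ioi (1 : ℝ) ×ˢ spectrum ℝ a, Real.sqrt (p.1 ^ 2 - 1) ≠ 0 := by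
      rintro ⟨s, x⟩ ⟨hs, -⟩
      have : (1 : ℝ) < s := hs
      exact (Real.sqrt_pos.2 (by nlinarith)).ne'
    have h2 : ∀ p ∈ Set.Ioi (1 : ℝ) ×ˢ spectrum ℝ a, p.2 ^ 2 + p.1 ^ 2 ≠ 0 := by
      rintro ⟨s, x⟩ ⟨hs, -⟩
      exact hne s (le_of_lt hs) x
    unfold Function.uncurry
    exact ContinuousOn.mul (ContinuousOn.div (by fun_prop) (by fun_prop) h1)
      (ContinuousOn.mul (by fun_prop) (ContinuousOn.inv₀ (by fun_prop) h2))
  · refine ae_restrict_of_forall_mem measurableSet_Ioi fun s hs z hz => ?_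
    have hs' : (1 : ℝ) < s := hs
    have h0 : 0 ≤ M := (norm_nonneg z).trans (hM z hz)
    have h3 : (z ^ 2 + s ^ 2)⁻¹ ≤ (0 ^ 2 + s ^ 2)⁻¹ := by
      apply inv_anti₀ (by positivity)
      nlinarith [sq_nonneg z]
    rw [norm_mul, norm_mul, Real.norm_of_nonneg (by positivity : 0 ≤ s / Real.sqrt (s ^ 2 - 1)),
      Real.norm_of_nonneg (by positivity : 0 ≤ (z ^ 2 + s ^ 2)⁻¹), mul_left_comm]
    gcongr
    exact hM z hz
end

section
/- Let A be a unital C*-algebra, let a, b ∈ A be selfadjoint, and let g : ℝ → ℝ be the function g(x) = x/√(1+x²). For every real s ≥ 1, the elements a + is·1, a − is·1, a + b + is·1 and a + b − is·1 are invertible in A, and one has the Bochner-integral identity g(a) − g(a+b) = (1/π)·∫₁^∞ (s/√(s²−1)) · [ (a + is·1)⁻¹ · b · (a + b + is·1)⁻¹ + (a − is·1)⁻¹ · b · (a + b − is·1)⁻¹ ] ds, where g(a) and g(a+b) are defined via the continuous functional calculus. -/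
open MeasureTheory

lemma s7_isUnit {A : Type*} [CStarAlgebra A] (a : A) (ha : IsSelfAdjoint a) (z : ℂ)
    (hz : z.im ≠ 0) : IsUnit (a + z • (1 : A)) := by
  by_contra h
  have : -z ∈ spectrum ℂ a := by
    rw [spectrum.mem_iff, Algebra.algebraMap_eq_smul_one]
    intro h'
    apply h
    have := h'.neg
    simpa [add_comm] using this
  have h2 := ha.im_eq_zero_of_mem_spectrum this
  simp at h2
  exact hz h2

lemma s7_resolvent {A : Type*} [CStarAlgebra A] (a b : A) (P : A) (hP : IsUnit (a + P))
    (hQ : IsUnit (a + b + P)) :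
    Ring.inverse (a + P) * b * Ring.inverse (a + b + P) =
      Ring.inverse (a + P) - Ring.inverse (a + b + P) := by
  have : b = (a + b + P) - (a + P) := by abel
  have h : Ring.inverse (a + P) * ((a + b + P) - (a + P)) * Ring.inverse (a + b + P) =
      Ring.inverse (a + P) - Ring.inverse (a + b + P) := by
    rw [mul_sub, sub_mul, mul_assoc, Ring.mul_inverse_cancel _ hQ, Ring.inverse_mul_cancel _ hP]
    simp
  rwa [← this] at h

lemma s7_cfc {A : Type*} [CStarAlgebra A] (a : A) (ha : IsSelfAdjoint a) (s : ℝ) (hs : 0 < s) :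
    Ring.inverse (a + ((s : ℂ) * Complex.I) • (1 : A)) +
      Ring.inverse (a - ((s : ℂ) * Complex.I) • (1 : A)) =
    cfc (fun x : ℝ => 2 * x / (x ^ 2 + s ^ 2)) a := by
  have hP : IsUnit (a + ((s : ℂ) * Complex.I) • (1 : A)) := s7_isUnit a ha _ (by simp [hs.ne'])
  have hM : IsUnit (a - ((s : ℂ) * Complex.I) • (1 : A)) := by
    have := s7_isUnit a ha (-((s : ℂ) * Complex.I)) (by simp [hs.ne'])
    rwa [neg_smul, ← sub_eq_add_neg] at this
  have hne : ∀ x : ℝ, x ^ 2 + s ^ 2 ≠ 0 := fun x => by positivity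
  have hPM : (a + ((s : ℂ) * Complex.I) • (1 : A)) * (a - ((s : ℂ) * Complex.I) • (1 : A))
      = a ^ 2 + (s ^ 2) • (1 : A) := by
    have : ((s : ℂ) * Complex.I) * ((s : ℂ) * Complex.I) = -((s ^ 2 : ℝ) : ℂ) := by
      push_cast
      linear_combination (s : ℂ) ^ 2 * Complex.I_mul_I
    simp only [add_mul, mul_sub, smul_mul_assoc, mul_smul_comm, one_mul, mul_one, smul_add, smul_smul, this]
    rw [neg_smul, Complex.coe_smul, pow_two a]
    abel
  have hMP : (a - ((s : ℂ) * Complex.I) • (1 : A)) * (a + ((s : ℂ) * Complex.I) • (1 : A))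
      = (a + ((s : ℂ) * Complex.I) • (1 : A)) * (a - ((s : ℂ) * Complex.I) • (1 : A)) := by
    simp only [add_mul, mul_add, mul_sub, sub_mul, smul_mul_assoc, mul_smul_comm, one_mul, mul_one,
      smul_add, smul_sub]
    abel
  have hq : cfc (fun x : ℝ => x ^ 2 + s ^ 2) a = a ^ 2 + (s ^ 2) • (1 : A) := by
    rw [cfc_add_const (s ^ 2) (fun x : ℝ => x ^ 2) a, cfc_pow_id a 2,
      Algebra.algebraMap_eq_smul_one]
  have hX : cfc (fun x : ℝ => 2 * x / (x ^ 2 + s ^ 2)) a * (a ^ 2 + (s ^ 2) • (1 : A)) =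
      (a + ((s : ℂ) * Complex.I) • (1 : A)) + (a - ((s : ℂ) * Complex.I) • (1 : A)) := by
    rw [← hq, ← cfc_mul (fun x : ℝ => 2 * x / (x ^ 2 + s ^ 2)) (fun x : ℝ => x ^ 2 + s ^ 2) a
      (by fun_prop (disch := exact fun x _ => hne x)) (by fun_prop)]
    have : (fun x : ℝ => 2 * x / (x ^ 2 + s ^ 2) * (x ^ 2 + s ^ 2)) = fun x => 2 * x := by
      ext x; exact div_mul_cancel₀ _ (hne x)
    rw [this, cfc_const_mul_id (2 : ℝ) a, two_smul]
    abel
  rw [← hPM] at hX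
  generalize (a + ((s : ℂ) * Complex.I) • (1 : A)) = P at *
  generalize (a - ((s : ℂ) * Complex.I) • (1 : A)) = M at *
  obtain ⟨P, rfl⟩ := hP
  obtain ⟨M, rfl⟩ := hM
  rw [Ring.inverse_unit, Ring.inverse_unit]
  rw [← mul_assoc] at hX
  have h1 := congrArg (fun t => t * (↑M⁻¹ : A) * (↑P⁻¹ : A)) hX
  have hc : (P : A) * (↑M⁻¹ : A) = (↑M⁻¹ : A) * P := by
    rw [Units.mul_inv_eq_iff_eq_mul, mul_assoc, ← hMP, Units.inv_mul_cancel_left]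
  simp only [Units.mul_inv_cancel_right, add_mul, hc, Units.mul_inv, one_mul] at h1
  rw [h1, add_comm]

lemma s7_deriv (c : ℝ) (hc : 0 < c) (s : ℝ) (hs : 1 < s) :
    HasDerivAt (fun s : ℝ => Real.arctan (Real.sqrt (s ^ 2 - 1) / c) / c)
      (s / Real.sqrt (s ^ 2 - 1) * (1 / (c ^ 2 + (s ^ 2 - 1)))) s := by
  have h0 : 0 < s ^ 2 - 1 := by nlinarith
  have h1 : HasDerivAt (fun s : ℝ => s ^ 2 - 1) (2 * s) s := by
    simpa using (hasDerivAt_pow 2 s).sub_const 1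
  have h2 := (((h1.sqrt h0.ne').div_const c).arctan).div_const c
  refine h2.congr_deriv ?_
  have h3 : 0 < Real.sqrt (s ^ 2 - 1) := Real.sqrt_pos.2 h0
  have h4 := Real.sq_sqrt h0.le
  rw [div_pow, h4]
  have h5 : c ^ 2 + (s ^ 2 - 1) ≠ 0 := by positivity
  have h6 : 1 + (s ^ 2 - 1) / c ^ 2 = (c ^ 2 + (s ^ 2 - 1)) / c ^ 2 := by field_simp
  rw [h6]
  generalize c ^ 2 + (s ^ 2 - 1) = d at *
  field_simp

lemma s7_tendsto (c : ℝ) (hc : 0 < c) :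
    Filter.Tendsto (fun s : ℝ => Real.arctan (Real.sqrt (s ^ 2 - 1) / c) / c) Filter.atTop
      (nhds (Real.pi / 2 / c)) := by
  apply Filter.Tendsto.div_const
  apply (Real.tendsto_arctan_atTop.mono_right nhdsWithin_le_nhds).comp
  apply Filter.Tendsto.atTop_div_const hc
  apply Real.tendsto_sqrt_atTop.comp
  apply Filter.tendsto_atTop_add_const_right
  exact Filter.tendsto_pow_atTop two_ne_zero

lemma s7_int (c : ℝ) (hc : 0 < c) :
    IntegrableOn (fun s : ℝ => s / Real.sqrt (s ^ 2 - 1) * (1 / (c ^ 2 + (s ^ 2 - 1))))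
      (Set.Ioi 1) ∧
    ∫ s in Set.Ioi (1 : ℝ), s / Real.sqrt (s ^ 2 - 1) * (1 / (c ^ 2 + (s ^ 2 - 1))) =
      Real.pi / 2 / c := by
  have hcont : ContinuousWithinAt (fun s : ℝ => Real.arctan (Real.sqrt (s ^ 2 - 1) / c) / c)
      (Set.Ici 1) 1 := by
    apply Continuous.continuousWithinAt
    fun_prop
  have hpos : ∀ s ∈ Set.Ioi (1 : ℝ),
      0 ≤ s / Real.sqrt (s ^ 2 - 1) * (1 / (c ^ 2 + (s ^ 2 - 1))) := by
    intro s hs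
    have hs : 1 < s := hs
    have h0 : 0 < s ^ 2 - 1 := by nlinarith
    positivity
  refine ⟨integrableOn_Ioi_deriv_of_nonneg hcont (fun s hs => s7_deriv c hc s hs) hpos
    (s7_tendsto c hc), ?_⟩
  rw [integral_Ioi_of_hasDerivAt_of_nonneg hcont (fun s hs => s7_deriv c hc s hs) hpos
    (s7_tendsto c hc)]
  simp

lemma s7_scalar (x : ℝ) :
    ∫ s in Set.Ioi (1 : ℝ), s / Real.sqrt (s ^ 2 - 1) * (2 * x / (x ^ 2 + s ^ 2)) =
      Real.pi * (x / Real.sqrt (1 + x ^ 2)) := by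
  have hx : 0 < 1 + x ^ 2 := by positivity
  have h := (s7_int (Real.sqrt (1 + x ^ 2)) (Real.sqrt_pos.2 hx)).2
  rw [Real.sq_sqrt hx.le] at h
  have : (fun s : ℝ => s / Real.sqrt (s ^ 2 - 1) * (2 * x / (x ^ 2 + s ^ 2))) =
      fun s : ℝ => (2 * x) * (s / Real.sqrt (s ^ 2 - 1) * (1 / (1 + x ^ 2 + (s ^ 2 - 1)))) := by
    ext s
    rw [show 1 + x ^ 2 + (s ^ 2 - 1) = x ^ 2 + s ^ 2 by ring]
    ring
  rw [this, integral_const_mul, h]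
  ring

lemma s7_main {A : Type*} [CStarAlgebra A] (a : A) (ha : IsSelfAdjoint a) :
    IntegrableOn (fun s : ℝ => (s / Real.sqrt (s ^ 2 - 1)) •
      cfc (fun x : ℝ => 2 * x / (x ^ 2 + s ^ 2)) a) (Set.Ioi 1) ∧
    ∫ s in Set.Ioi (1 : ℝ), (s / Real.sqrt (s ^ 2 - 1)) •
      cfc (fun x : ℝ => 2 * x / (x ^ 2 + s ^ 2)) a =
    Real.pi • cfc (fun x : ℝ => x / Real.sqrt (1 + x ^ 2)) a := by
  have hc : ContinuousOn (Function.uncurry (fun s x : ℝ =>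
      s / Real.sqrt (s ^ 2 - 1) * (2 * x / (x ^ 2 + s ^ 2)))) (Set.Ioi 1 ×ˢ spectrum ℝ a) := by
    rintro ⟨s, x⟩ ⟨hs, -⟩
    have hs : 1 < s := hs
    have h0 : 0 < s ^ 2 - 1 := by nlinarith
    have h1 : Real.sqrt (s ^ 2 - 1) ≠ 0 := (Real.sqrt_pos.2 h0).ne'
    have h2 : x ^ 2 + s ^ 2 ≠ 0 := by positivity
    apply ContinuousAt.continuousWithinAt
    unfold Function.uncurry
    fun_prop (disch := assumption)
  have hb : ∀ᵐ s ∂(volume.restrict (Set.Ioi (1 : ℝ))), ∀ x ∈ spectrum ℝ a,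
      ‖s / Real.sqrt (s ^ 2 - 1) * (2 * x / (x ^ 2 + s ^ 2))‖ ≤
      (2 * (‖a‖ * ‖(1 : A)‖)) *
        (s / Real.sqrt (s ^ 2 - 1) * (1 / ((1 : ℝ) ^ 2 + (s ^ 2 - 1)))) := by
    refine ae_restrict_of_forall_mem measurableSet_Ioi fun s hs x hx => ?_
    have hs : 1 < s := hs
    have h0 : 0 < s ^ 2 - 1 := by nlinarith
    have hn := spectrum.norm_le_norm_mul_of_mem hx
    rw [norm_mul, Real.norm_of_nonneg (by positivity : 0 ≤ s / Real.sqrt (s ^ 2 - 1)), norm_div,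
      norm_mul, Real.norm_of_nonneg (by positivity : 0 ≤ x ^ 2 + s ^ 2), Real.norm_two,
      mul_left_comm, mul_one_div]
    have hd : (1 : ℝ) ^ 2 + (s ^ 2 - 1) ≤ x ^ 2 + s ^ 2 := by nlinarith [sq_nonneg x]
    have hd0 : 0 < (1 : ℝ) ^ 2 + (s ^ 2 - 1) := by positivity
    exact mul_le_mul_of_nonneg_left
      (div_le_div₀ (by positivity) (by linarith) hd0 hd) (by positivity)
  have hbi := ((s7_int 1 one_pos).1.const_mul (2 * (‖a‖ * ‖(1 : A)‖))).hasFiniteIntegral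
  have hsm : ∀ s : ℝ, s ∈ Set.Ioi (1 : ℝ) →
      cfc (fun x : ℝ => s / Real.sqrt (s ^ 2 - 1) * (2 * x / (x ^ 2 + s ^ 2))) a =
      (s / Real.sqrt (s ^ 2 - 1)) • cfc (fun x : ℝ => 2 * x / (x ^ 2 + s ^ 2)) a := by
    intro s hs
    have hs : 1 < s := hs
    have hne : ∀ x : ℝ, x ^ 2 + s ^ 2 ≠ 0 := fun x => by positivity
    exact cfc_const_mul _ _ a (by fun_prop (disch := exact fun x _ => hne x))
  constructor
  · exact (integrableOn_cfc measurableSet_Ioi _ _ a hc hb hbi ha).congr_fun hsm measurableSet_Ioi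
  · rw [← setIntegral_congr_fun measurableSet_Ioi hsm,
      ← cfc_setIntegral measurableSet_Ioi _ _ a hc hb hbi ha]
    simp only [s7_scalar]
    have hne : ∀ x : ℝ, Real.sqrt (1 + x ^ 2) ≠ 0 := fun x => by positivity
    exact cfc_const_mul _ _ a (by fun_prop (disch := exact fun x _ => hne x))

/-- perturbation identity from the proof of Lemma 3.4.
Let `a`, `b` be selfadjoint elements of a unital C*-algebra `A`, and let
`g(x) = x/√(1+x²)`.  For every real `s ≥ 1` the elements `a ± is·1` and
`a + b ± is·1` are invertible, and
`g(a) − g(a+b) = (1/π)·∫₁^∞ (s/√(s²−1)) ·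
  [(a+is)⁻¹·b·(a+b+is)⁻¹ + (a−is)⁻¹·b·(a+b−is)⁻¹] ds`. -/
theorem statement7 {A : Type*} [CStarAlgebra A]
    (a b : A) (ha : IsSelfAdjoint a) (hb : IsSelfAdjoint b) :
    (∀ s : ℝ, 1 ≤ s →
      IsUnit (a + ((s : ℂ) * Complex.I) • (1 : A)) ∧
      IsUnit (a - ((s : ℂ) * Complex.I) • (1 : A)) ∧
      IsUnit (a + b + ((s : ℂ) * Complex.I) • (1 : A)) ∧
      IsUnit (a + b - ((s : ℂ) * Complex.I) • (1 : A))) ∧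
    cfc (fun x : ℝ => x / Real.sqrt (1 + x ^ 2)) a -
        cfc (fun x : ℝ => x / Real.sqrt (1 + x ^ 2)) (a + b) =
      (1 / Real.pi) • ∫ s in Set.Ioi (1 : ℝ),
        (s / Real.sqrt (s ^ 2 - 1)) •
          (Ring.inverse (a + ((s : ℂ) * Complex.I) • (1 : A)) * b *
              Ring.inverse (a + b + ((s : ℂ) * Complex.I) • (1 : A)) +
            Ring.inverse (a - ((s : ℂ) * Complex.I) • (1 : A)) * b *
              Ring.inverse (a + b - ((s : ℂ) * Complex.I) • (1 : A))) := by
  have hab : IsSelfAdjoint (a + b) := ha.add hb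
  have hu : ∀ s : ℝ, 1 ≤ s →
      IsUnit (a + ((s : ℂ) * Complex.I) • (1 : A)) ∧
      IsUnit (a - ((s : ℂ) * Complex.I) • (1 : A)) ∧
      IsUnit (a + b + ((s : ℂ) * Complex.I) • (1 : A)) ∧
      IsUnit (a + b - ((s : ℂ) * Complex.I) • (1 : A)) := by
    intro s hs
    have hs0 : s ≠ 0 := by linarith
    have h1 : ((s : ℂ) * Complex.I).im ≠ 0 := by simpa using hs0
    have h2 : (-((s : ℂ) * Complex.I)).im ≠ 0 := by simpa using hs0
    refine ⟨s7_isUnit a ha _ h1, ?_, s7_isUnit _ hab _ h1, ?_⟩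
    · simpa [sub_eq_add_neg] using s7_isUnit a ha _ h2
    · simpa [sub_eq_add_neg] using s7_isUnit _ hab _ h2
  refine ⟨hu, ?_⟩
  obtain ⟨i1, e1⟩ := s7_main a ha
  obtain ⟨i2, e2⟩ := s7_main (a + b) hab
  have key : ∀ s ∈ Set.Ioi (1 : ℝ), (s / Real.sqrt (s ^ 2 - 1)) •
          (Ring.inverse (a + ((s : ℂ) * Complex.I) • (1 : A)) * b *
              Ring.inverse (a + b + ((s : ℂ) * Complex.I) • (1 : A)) +
            Ring.inverse (a - ((s : ℂ) * Complex.I) • (1 : A)) * b *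
              Ring.inverse (a + b - ((s : ℂ) * Complex.I) • (1 : A))) =
      (s / Real.sqrt (s ^ 2 - 1)) • cfc (fun x : ℝ => 2 * x / (x ^ 2 + s ^ 2)) a -
      (s / Real.sqrt (s ^ 2 - 1)) • cfc (fun x : ℝ => 2 * x / (x ^ 2 + s ^ 2)) (a + b) := by
    intro s hs
    have hs : 1 < s := hs
    obtain ⟨u1, u2, u3, u4⟩ := hu s hs.le
    rw [← smul_sub, ← s7_cfc a ha s (by linarith), ← s7_cfc (a + b) hab s (by linarith),
      s7_resolvent a b _ u1 u3]
    have := s7_resolvent a b (-(((s : ℂ) * Complex.I) • (1 : A)))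
      (by rwa [← sub_eq_add_neg]) (by rwa [← sub_eq_add_neg])
    rw [← sub_eq_add_neg, ← sub_eq_add_neg] at this
    rw [this]
    congr 1
    abel
  rw [setIntegral_congr_fun measurableSet_Ioi key, integral_sub i1 i2, e1, e2, ← smul_sub,
    smul_smul, one_div_mul_cancel Real.pi_ne_zero, one_smul]
end
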